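/- arXiv:2005.14307 — 2 statements merged into one kernel-verified Lean document; each statement's English description precedes it below -/
import Mathlib

section
/- Let A, B ⊆ ℕ be infinite and let α, β ∈ ℝ. If the density of A exists and equals α and the density of B exists and equals β, then the density of B ▷ A exists and equals αβ. -/
open Filter Set Topology

open scoped Classical

/-- The density of `A` at `n`: `|A ∩ {0,…,n−1}| / n`. -/
noncomputable def pdens (A : Set ℕ) (n : ℕ) : ℝ :=
  ((Finset.range n).filter (· ∈ A)).card / n

/-- The upper density of `A`. -/
noncomputable def upperDensity (A : Set ℕ) : ℝ :=
  Filter.limsup (pdens A) Filter.atTop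

/-- The lower density of `A`. -/
noncomputable def lowerDensity (A : Set ℕ) : ℝ :=
  Filter.liminf (pdens A) Filter.atTop

/-- `A` has (asymptotic) density `r`. -/
def HasDensity (A : Set ℕ) (r : ℝ) : Prop :=
  Filter.Tendsto (pdens A) Filter.atTop (nhds r)

/-- The `n`-th element of `A` in increasing order. -/
noncomputable def nthElem (A : Set ℕ) (n : ℕ) : ℕ :=
  Nat.nth (· ∈ A) n

/-- A computable permutation of `ℕ`. -/
def IsComputablePerm (π : ℕ → ℕ) : Prop :=
  Function.Bijective π ∧ Computable π

/-- `A` has intrinsic density `r`: the density of `π(A)` exists and equals `r`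
for every computable permutation `π`. -/
def HasIntrinsicDensity (A : Set ℕ) (r : ℝ) : Prop :=
  ∀ π : ℕ → ℕ, IsComputablePerm π → HasDensity (π '' A) r

/-- The join `A ⊕ B = {2n : n ∈ A} ∪ {2n+1 : n ∈ B}`. -/
def join (A B : Set ℕ) : Set ℕ :=
  (fun n => 2 * n) '' A ∪ (fun n => 2 * n + 1) '' B

/-- `B ▷ A`, "`B` into `A`": the set of `B`-th elements of `A`. -/
noncomputable def into (B A : Set ℕ) : Set ℕ :=
  nthElem A '' B

/-- `B ◁ A`, "`B` within `A`": `{n : a_n ∈ B}`. -/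
noncomputable def within (B A : Set ℕ) : Set ℕ :=
  {n | nthElem A n ∈ B}

theorem card_filter_into {A : Set ℕ} (hA : A.Infinite) (B : Set ℕ) (n : ℕ) :
    ((Finset.range n).filter (· ∈ into B A)).card =
      ((Finset.range (Nat.count (· ∈ A) n)).filter (· ∈ B)).card := by
  have hlt : ∀ a, a < Nat.count (· ∈ A) n ↔ nthElem A a < n := fun a =>
    Nat.lt_nth_iff_count_lt (p := (· ∈ A)) hA
  rw [← Finset.card_image_of_injective
    ((Finset.range (Nat.count (· ∈ A) n)).filter (· ∈ B)) (Nat.nth_injective hA)]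
  congr 1
  ext x
  simp only [Finset.mem_filter, Finset.mem_range, Finset.mem_image, into, Set.mem_image, hlt]
  constructor
  · rintro ⟨hx, b, hb, rfl⟩
    exact ⟨b, ⟨hx, hb⟩, rfl⟩
  · rintro ⟨b, ⟨hx, hb⟩, rfl⟩
    exact ⟨hx, b, hb, rfl⟩

theorem pdens_into {A : Set ℕ} (hA : A.Infinite) (B : Set ℕ) (n : ℕ) :
    pdens (into B A) n = pdens A n * pdens B (Nat.count (· ∈ A) n) := by
  simp only [pdens, card_filter_into hA, ← Nat.count_eq_card_filter_range]
  rcases eq_or_ne (Nat.count (· ∈ A) n) 0 with h | h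
  · simp [h]
  · field_simp

theorem tendsto_count_atTop {A : Set ℕ} (hA : A.Infinite) :
    Tendsto (Nat.count (· ∈ A)) atTop atTop :=
  tendsto_atTop_atTop_of_monotone (Nat.count_monotone _) fun b =>
    ⟨Nat.nth (· ∈ A) b, (Nat.count_nth_of_infinite (p := (· ∈ A)) hA b).ge⟩

theorem stmt12 (A B : Set ℕ) (hA : A.Infinite) (hB : B.Infinite) (α β : ℝ)
    (hdA : HasDensity A α) (hdB : HasDensity B β) :
    HasDensity (into B A) (α * β) := by
  unfold HasDensity
  rw [funext (pdens_into hA B)]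
  exact hdA.mul (hdB.comp (tendsto_count_atTop hA))
end

section
/- Let A, B ⊆ ℕ. Then the absolute lower density of A ⊕ B is at most the minimum of the absolute lower densities of A and B, and the absolute upper density of A ⊕ B is at least the maximum of the absolute upper densities of A and B: P_(A ⊕ B) ≤ min(P_(A), P_(B)) and P̄(A ⊕ B) ≥ max(P̄(A), P̄(B)). -/
open Filter Set Topology

open scoped Classical

/-- The absolute upper density of `A`. -/
noncomputable def absUpperDensity (A : Set ℕ) : ℝ :=
  sSup {x : ℝ | ∃ π : ℕ → ℕ, IsComputablePerm π ∧ x = upperDensity (π '' A)}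

/-- The absolute lower density of `A`. -/
noncomputable def absLowerDensity (A : Set ℕ) : ℝ :=
  sInf {x : ℝ | ∃ π : ℕ → ℕ, IsComputablePerm π ∧ x = lowerDensity (π '' A)}

lemma pdens_nonneg (A : Set ℕ) (n : ℕ) : 0 ≤ pdens A n := by
  unfold pdens
  positivity

lemma pdens_le_one (A : Set ℕ) (n : ℕ) : pdens A n ≤ 1 := by
  unfold pdens
  refine div_le_one_of_le₀ ?_ (Nat.cast_nonneg n)
  exact_mod_cast (Finset.card_filter_le _ _).trans (Finset.card_range n).le

lemma isBoundedUnder_le_pdens (A : Set ℕ) : IsBoundedUnder (· ≤ ·) atTop (pdens A) :=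
  isBoundedUnder_of ⟨1, pdens_le_one A⟩

lemma isBoundedUnder_ge_pdens (A : Set ℕ) : IsBoundedUnder (· ≥ ·) atTop (pdens A) :=
  isBoundedUnder_of ⟨0, pdens_nonneg A⟩

lemma upperDensity_le_one (A : Set ℕ) : upperDensity A ≤ 1 :=
  limsup_le_of_le (isBoundedUnder_ge_pdens A).isCoboundedUnder_le
    (Eventually.of_forall (pdens_le_one A))

lemma lowerDensity_nonneg (A : Set ℕ) : 0 ≤ lowerDensity A :=
  le_liminf_of_le (isBoundedUnder_le_pdens A).isCoboundedUnder_ge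
    (Eventually.of_forall (pdens_nonneg A))

lemma upperDensity_le_of_tendsto_sub {A B : Set ℕ}
    (h : Tendsto (fun n => pdens A n - pdens B n) atTop (𝓝 0)) :
    upperDensity A ≤ upperDensity B := by
  have hAB : pdens A = (fun n => pdens A n - pdens B n) + pdens B := by
    ext n
    simp
  calc upperDensity A = limsup ((fun n => pdens A n - pdens B n) + pdens B) atTop := by
        rw [upperDensity, ← hAB]
    _ ≤ limsup (fun n => pdens A n - pdens B n) atTop + limsup (pdens B) atTop :=
        limsup_add_le h.isBoundedUnder_ge h.isBoundedUnder_le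
          (isBoundedUnder_ge_pdens B).isCoboundedUnder_le (isBoundedUnder_le_pdens B)
    _ = upperDensity B := by rw [h.limsup_eq, zero_add, upperDensity]

lemma lowerDensity_le_of_tendsto_sub {A B : Set ℕ}
    (h : Tendsto (fun n => pdens B n - pdens A n) atTop (𝓝 0)) :
    lowerDensity A ≤ lowerDensity B := by
  have hAB : pdens B = (fun n => pdens B n - pdens A n) + pdens A := by
    ext n
    simp
  calc lowerDensity A = liminf (fun n => pdens B n - pdens A n) atTop + liminf (pdens A) atTop := by
        rw [h.liminf_eq, zero_add, lowerDensity]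
    _ ≤ liminf ((fun n => pdens B n - pdens A n) + pdens A) atTop :=
        le_liminf_add h.isBoundedUnder_ge h.isBoundedUnder_le
          (isBoundedUnder_ge_pdens A) (isBoundedUnder_le_pdens A).isCoboundedUnder_ge
    _ = lowerDensity B := by rw [← hAB, lowerDensity]

/-- The `m`-th natural number that is not a perfect square. -/
def nonSquare (m : ℕ) : ℕ :=
  if m < m.sqrt * m.sqrt + m.sqrt then m + m.sqrt + 1 else m + m.sqrt + 2

lemma computable_nonSquare : Computable nonSquare := by
  have hs : Primrec fun m : ℕ => m + m.sqrt := Primrec.nat_add.comp .id Primrec.nat_sqrt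
  have hlt : PrimrecPred fun m : ℕ => m < m.sqrt * m.sqrt + m.sqrt :=
    Primrec.nat_lt.comp .id (Primrec.nat_add.comp
      (Primrec.nat_mul.comp Primrec.nat_sqrt Primrec.nat_sqrt) Primrec.nat_sqrt)
  refine (Primrec.of_eq (Primrec.ite hlt (Primrec.nat_add.comp hs (Primrec.const 1))
    (Primrec.nat_add.comp hs (Primrec.const 2))) fun m => ?_).to_comp
  rfl

lemma le_nonSquare (m : ℕ) : m ≤ nonSquare m := by
  unfold nonSquare
  split_ifs <;> omega

lemma nonSquare_le (m : ℕ) : nonSquare m ≤ m + m.sqrt + 2 := by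
  unfold nonSquare
  split_ifs <;> omega

lemma exists_nonSquare_eq (m : ℕ) :
    ∃ k, nonSquare m = m + 1 + k ∧ k * k < nonSquare m ∧ nonSquare m < (k + 1) * (k + 1) := by
  have h₁ := Nat.sqrt_le m
  have h₂ := Nat.sqrt_le_add m
  unfold nonSquare
  generalize m.sqrt = s at *
  split_ifs with h
  · exact ⟨s, by omega, by omega, by nlinarith⟩
  · exact ⟨s + 1, by omega, by nlinarith, by nlinarith⟩

lemma nonSquare_eq_add_sqrt (m : ℕ) : nonSquare m = m + 1 + (nonSquare m).sqrt := by
  obtain ⟨k, hk, h₁, h₂⟩ := exists_nonSquare_eq m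
  rw [← Nat.eq_sqrt.2 ⟨h₁.le, h₂⟩]
  exact hk

lemma nonSquare_injective : Function.Injective nonSquare := fun a b h => by
  have ha := nonSquare_eq_add_sqrt a
  have hb := nonSquare_eq_add_sqrt b
  rw [h] at ha
  omega

lemma nonSquare_ne_mul_self (m k : ℕ) : nonSquare m ≠ k * k := by
  intro h
  obtain ⟨l, -, h₁, h₂⟩ := exists_nonSquare_eq m
  rw [h] at h₁ h₂
  have := Nat.mul_self_lt_mul_self_iff.1 h₁
  have := Nat.mul_self_lt_mul_self_iff.1 h₂
  omega

lemma exists_nonSquare_eq_of_ne {x : ℕ} (hx : x ≠ x.sqrt * x.sqrt) : ∃ m, nonSquare m = x := by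
  have h₁ := Nat.sqrt_le x
  have h₂ := Nat.sqrt_le_add x
  generalize x.sqrt = k at *
  obtain ⟨d, rfl, hd⟩ : ∃ d, x = k * k + 1 + d ∧ d < 2 * k := ⟨x - (k * k + 1), by omega, by omega⟩
  obtain ⟨j, rfl⟩ : ∃ j, k = j + 1 := ⟨k - 1, by omega⟩
  refine ⟨(j + 1) * j + d, ?_⟩
  obtain ⟨l, hl, h₃, h₄⟩ := exists_nonSquare_eq ((j + 1) * j + d)
  suffices l = j + 1 by
    rw [hl, this]
    ring
  rw [hl] at h₃ h₄
  apply le_antisymm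
  · by_contra! h
    nlinarith
  · by_contra! h
    nlinarith

/-- The map sending the even numbers to the non-squares, in the order given by `π`, and the odd
numbers to the squares. -/
def spread (π : ℕ → ℕ) (n : ℕ) : ℕ :=
  bif n.bodd then n.div2 * n.div2 else nonSquare (π n.div2)

lemma spread_two_mul (π : ℕ → ℕ) (n : ℕ) : spread π (2 * n) = nonSquare (π n) := by
  simp [spread, Nat.div2_val]

lemma spread_two_mul_add_one (π : ℕ → ℕ) (n : ℕ) : spread π (2 * n + 1) = n * n := by
  simp [spread, Nat.div2_val]

lemma IsComputablePerm.spread {π : ℕ → ℕ} (hπ : IsComputablePerm π) :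
    IsComputablePerm (spread π) := by
  refine ⟨⟨fun a b h => ?_, fun x => ?_⟩, ?_⟩
  · obtain ⟨m, rfl | rfl⟩ := Nat.even_or_odd' a <;> obtain ⟨n, rfl | rfl⟩ := Nat.even_or_odd' b
    · rw [spread_two_mul, spread_two_mul] at h
      rw [hπ.1.1 (nonSquare_injective h)]
    · rw [spread_two_mul, spread_two_mul_add_one] at h
      exact absurd h (nonSquare_ne_mul_self _ _)
    · rw [spread_two_mul, spread_two_mul_add_one] at h
      exact absurd h.symm (nonSquare_ne_mul_self _ _)
    · rw [spread_two_mul_add_one, spread_two_mul_add_one] at h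
      rw [Nat.mul_self_inj.1 h]
  · by_cases hx : x = x.sqrt * x.sqrt
    · exact ⟨2 * x.sqrt + 1, by rw [spread_two_mul_add_one, ← hx]⟩
    · obtain ⟨m, rfl⟩ := exists_nonSquare_eq_of_ne hx
      obtain ⟨n, rfl⟩ := hπ.1.2 m
      exact ⟨2 * n, spread_two_mul π n⟩
  · exact Computable.cond Computable.nat_bodd
      (Primrec.nat_mul.comp Primrec.nat_div2 Primrec.nat_div2).to_comp
      (computable_nonSquare.comp (hπ.2.comp Computable.nat_div2))

lemma nonSquare_mem_spread_image_join (π : ℕ → ℕ) {A : Set ℕ} (B : Set ℕ) {x : ℕ}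
    (hx : x ∈ π '' A) : nonSquare x ∈ spread π '' join A B := by
  obtain ⟨a, ha, rfl⟩ := hx
  exact ⟨2 * a, Or.inl ⟨a, ha, rfl⟩, spread_two_mul π a⟩

lemma card_image_le_card_spread_image_join (π : ℕ → ℕ) (A B : Set ℕ) (N : ℕ) :
    ((Finset.range N).filter (· ∈ π '' A)).card ≤
      ((Finset.range N).filter (· ∈ spread π '' join A B)).card + (N.sqrt + 2) := by
  set S := (Finset.range N).filter (· ∈ π '' A)
  have hsub : S ⊆ S.filter (nonSquare · < N) ∪ Finset.Ico (N - (N.sqrt + 2)) N := by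
    intro x hx
    have hxN : x < N := Finset.mem_range.1 (Finset.mem_filter.1 hx).1
    have h₁ := nonSquare_le x
    have h₂ := Nat.sqrt_le_sqrt hxN.le
    simp only [Finset.mem_union, Finset.mem_filter, Finset.mem_Ico, hx, true_and]
    omega
  have hcard : (S.filter (nonSquare · < N)).card ≤
      ((Finset.range N).filter (· ∈ spread π '' join A B)).card := by
    refine Finset.card_le_card_of_injOn nonSquare (fun x hx => ?_) nonSquare_injective.injOn
    obtain ⟨hx, hxN⟩ := Finset.mem_filter.1 hx
    exact Finset.mem_filter.2 ⟨Finset.mem_range.2 hxN,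
      nonSquare_mem_spread_image_join π B (Finset.mem_filter.1 hx).2⟩
  have h := (Finset.card_le_card hsub).trans (Finset.card_union_le _ _)
  rw [Nat.card_Ico] at h
  omega

lemma card_spread_image_join_le_card_image (π : ℕ → ℕ) (A B : Set ℕ) (N : ℕ) :
    ((Finset.range N).filter (· ∈ spread π '' join A B)).card ≤
      ((Finset.range N).filter (· ∈ π '' A)).card + (N.sqrt + 2) := by
  have hsub : (Finset.range N).filter (· ∈ spread π '' join A B) ⊆
      ((Finset.range N).filter (· ∈ π '' A)).image nonSquare ∪
        (Finset.range (N.sqrt + 1)).image fun k => k * k := by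
    intro x hx
    obtain ⟨hxN, y, hy, rfl⟩ := Finset.mem_filter.1 hx
    rw [Finset.mem_range] at hxN
    rw [Finset.mem_union, Finset.mem_image, Finset.mem_image]
    rcases hy with ⟨a, ha, rfl⟩ | ⟨b, -, rfl⟩
    · simp only [spread_two_mul] at hxN ⊢
      exact Or.inl ⟨π a, Finset.mem_filter.2
        ⟨Finset.mem_range.2 ((le_nonSquare _).trans_lt hxN), mem_image_of_mem π ha⟩, rfl⟩
    · simp only [spread_two_mul_add_one] at hxN ⊢
      exact Or.inr ⟨b, Finset.mem_range.2 (Nat.lt_succ_of_le (Nat.le_sqrt.2 hxN.le)), rfl⟩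
  have h := (Finset.card_le_card hsub).trans (Finset.card_union_le _ _)
  have h₁ := Finset.card_image_le (s := (Finset.range N).filter (· ∈ π '' A)) (f := nonSquare)
  have h₂ := Finset.card_image_le (s := Finset.range (N.sqrt + 1)) (f := fun k => k * k)
  rw [Finset.card_range] at h₂
  omega

lemma tendsto_natSqrt_add_two_div_atTop :
    Tendsto (fun N : ℕ => ((N.sqrt + 2 : ℕ) : ℝ) / N) atTop (𝓝 0) := by
  have h₁ : Tendsto (fun N : ℕ => (√(N : ℝ))⁻¹ + 2 / (N : ℝ)) atTop (𝓝 0) := by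
    have h := (tendsto_inv_atTop_zero.comp
      (Real.tendsto_sqrt_atTop.comp tendsto_natCast_atTop_atTop)).add
        (tendsto_const_div_atTop_nhds_zero_nat (2 : ℝ))
    simpa using h
  refine squeeze_zero (fun N => by positivity) (fun N => ?_) h₁
  rw [← Real.sqrt_div_self, ← add_div]
  gcongr
  push_cast
  gcongr
  exact Real.nat_sqrt_le_real_sqrt

lemma tendsto_pdens_spread_sub (π : ℕ → ℕ) (A B : Set ℕ) :
    Tendsto (fun N => pdens (spread π '' join A B) N - pdens (π '' A) N) atTop (𝓝 0) := by
  refine squeeze_zero_norm (fun N => ?_) tendsto_natSqrt_add_two_div_atTop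
  have h₁ : (_ : ℝ) ≤ _ := Nat.cast_le.2 (card_image_le_card_spread_image_join π A B N)
  have h₂ : (_ : ℝ) ≤ _ := Nat.cast_le.2 (card_spread_image_join_le_card_image π A B N)
  rw [Nat.cast_add] at h₁ h₂
  rw [pdens, pdens, ← sub_div, norm_div, Real.norm_natCast]
  gcongr
  rw [Real.norm_eq_abs, abs_le]
  constructor <;> linarith

lemma upperDensity_spread_image_join (π : ℕ → ℕ) (A B : Set ℕ) :
    upperDensity (spread π '' join A B) = upperDensity (π '' A) :=
  le_antisymm (upperDensity_le_of_tendsto_sub (tendsto_pdens_spread_sub π A B))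
    (upperDensity_le_of_tendsto_sub (by simpa using (tendsto_pdens_spread_sub π A B).neg))

lemma lowerDensity_spread_image_join (π : ℕ → ℕ) (A B : Set ℕ) :
    lowerDensity (spread π '' join A B) = lowerDensity (π '' A) :=
  le_antisymm
    (lowerDensity_le_of_tendsto_sub (by simpa using (tendsto_pdens_spread_sub π A B).neg))
    (lowerDensity_le_of_tendsto_sub (tendsto_pdens_spread_sub π A B))

/-- The involution exchanging `2 * n` and `2 * n + 1`. -/
def swapParity (n : ℕ) : ℕ :=
  bif n.bodd then n - 1 else n + 1

lemma swapParity_two_mul (n : ℕ) : swapParity (2 * n) = 2 * n + 1 := by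
  simp [swapParity]

lemma swapParity_two_mul_add_one (n : ℕ) : swapParity (2 * n + 1) = 2 * n := by
  simp [swapParity]

lemma swapParity_involutive : Function.Involutive swapParity := fun n => by
  obtain ⟨m, rfl | rfl⟩ := Nat.even_or_odd' n <;>
    simp only [swapParity_two_mul, swapParity_two_mul_add_one]

lemma isComputablePerm_swapParity : IsComputablePerm swapParity :=
  ⟨swapParity_involutive.bijective,
    Computable.cond Computable.nat_bodd Primrec.pred.to_comp Computable.succ⟩

lemma swapParity_image_join (A B : Set ℕ) : swapParity '' join A B = join B A := by
  simp only [_root_.join, image_union, image_image, swapParity_two_mul, swapParity_two_mul_add_one]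
  exact union_comm _ _

lemma IsComputablePerm.comp {π σ : ℕ → ℕ} (hπ : IsComputablePerm π) (hσ : IsComputablePerm σ) :
    IsComputablePerm (π ∘ σ) :=
  ⟨hπ.1.comp hσ.1, hπ.2.comp hσ.2⟩

lemma isComputablePerm_id : IsComputablePerm id :=
  ⟨Function.bijective_id, Computable.id⟩

lemma absUpperDensity_le_of_forall_exists {A B : Set ℕ}
    (h : ∀ π, IsComputablePerm π →
      ∃ σ, IsComputablePerm σ ∧ upperDensity (σ '' B) = upperDensity (π '' A)) :
    absUpperDensity A ≤ absUpperDensity B := by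
  refine csSup_le_csSup ⟨1, ?_⟩ ⟨_, id, isComputablePerm_id, rfl⟩ ?_
  · rintro _ ⟨π, -, rfl⟩
    exact upperDensity_le_one _
  · rintro _ ⟨π, hπ, rfl⟩
    obtain ⟨σ, hσ, hσπ⟩ := h π hπ
    exact ⟨σ, hσ, hσπ.symm⟩

lemma absLowerDensity_le_of_forall_exists {A B : Set ℕ}
    (h : ∀ π, IsComputablePerm π →
      ∃ σ, IsComputablePerm σ ∧ lowerDensity (σ '' B) = lowerDensity (π '' A)) :
    absLowerDensity B ≤ absLowerDensity A := by
  refine csInf_le_csInf ⟨0, ?_⟩ ⟨_, id, isComputablePerm_id, rfl⟩ ?_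
  · rintro _ ⟨π, -, rfl⟩
    exact lowerDensity_nonneg _
  · rintro _ ⟨π, hπ, rfl⟩
    obtain ⟨σ, hσ, hσπ⟩ := h π hπ
    exact ⟨σ, hσ, hσπ.symm⟩

theorem stmt18 (A B : Set ℕ) :
    absLowerDensity (join A B) ≤ min (absLowerDensity A) (absLowerDensity B) ∧
    absUpperDensity (join A B) ≥ max (absUpperDensity A) (absUpperDensity B) := by
  refine ⟨le_min ?_ ?_, max_le ?_ ?_⟩
  · exact absLowerDensity_le_of_forall_exists fun π hπ =>
      ⟨spread π, hπ.spread, lowerDensity_spread_image_join π A B⟩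
  · refine absLowerDensity_le_of_forall_exists fun π hπ =>
      ⟨spread π ∘ swapParity, hπ.spread.comp isComputablePerm_swapParity, ?_⟩
    rw [image_comp, swapParity_image_join, lowerDensity_spread_image_join]
  · exact absUpperDensity_le_of_forall_exists fun π hπ =>
      ⟨spread π, hπ.spread, upperDensity_spread_image_join π A B⟩
  · refine absUpperDensity_le_of_forall_exists fun π hπ =>
      ⟨spread π ∘ swapParity, hπ.spread.comp isComputablePerm_swapParity, ?_⟩
    rw [image_comp, swapParity_image_join, upperDensity_spread_image_join]
end
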